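/- arXiv:1407.0055 — 2 statements merged into one kernel-verified Lean document; each statement's English description precedes it below -/
import Mathlib

section
/- Let g ∈ S(d) ⊂ C(d) be a pure permutation whose cycle type is an odd partition γ of d. Then the centralizer of g in the Sergeev group C(d) has order 2^{ℓ(γ)+1}·z_γ, where ℓ(γ) is the number of parts of γ and z_γ = ∏_k k^{γ(k)} γ(k)! with γ(k) the number of parts of γ equal to k. Consequently the conjugacy class C_γ of g in C(d) satisfies |C_γ| = |C(d)| / (2^{ℓ(γ)+1} z_γ). -/
/-- Relations of the Clifford group `Cliff(d)`: generators `ξ i = of (some i)` and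
`ε = of none`, with `ξ i ² = 1`, `ε² = 1`, `ε` central, and
`ξ i ξ j = ε ξ j ξ i` for `i ≠ j`. -/
def cliffRels (d : ℕ) : Set (FreeGroup (Option (Fin d))) :=
  {r | (∃ i : Fin d, r = .of (some i) * .of (some i)) ∨
    r = .of none * .of none ∨
    (∃ i : Fin d, r = .of none * .of (some i) * (.of none)⁻¹ * (.of (some i))⁻¹) ∨
    (∃ i j : Fin d, i ≠ j ∧
      r = .of (some i) * .of (some j) * ((.of none) * .of (some j) * .of (some i))⁻¹)}

/-- The Clifford group `Cliff(d)`. -/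
def CliffordGroup (d : ℕ) : Type := PresentedGroup (cliffRels d)

instance (d : ℕ) : Group (CliffordGroup d) := by unfold CliffordGroup; infer_instance

/-- The generator `ξ i` of the Clifford group. -/
def cliffXi {d : ℕ} (i : Fin d) : CliffordGroup d := PresentedGroup.of (some i)

/-- The central generator `ε` of the Clifford group. -/
def cliffEps (d : ℕ) : CliffordGroup d := PresentedGroup.of none

open SemidirectProduct

namespace CliffordGroup

variable {d : ℕ}

/-- The homomorphism out of the Clifford group determined by elements satisfying its defining
relations. -/
def lift {G : Type*} [Group G] (x : Fin d → G) (e : G) (hx : ∀ i, x i * x i = 1)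
    (he : e * e = 1) (hc : ∀ i, e * x i = x i * e)
    (ha : ∀ i j, i ≠ j → x i * x j = e * x j * x i) : CliffordGroup d →* G :=
  PresentedGroup.toGroup (rels := cliffRels d) (f := fun o : Option (Fin d) => o.elim e x) <| by
    rintro r (⟨i, rfl⟩ | rfl | ⟨i, rfl⟩ | ⟨i, j, hij, rfl⟩)
    · simpa using hx i
    · simpa using he
    · simp [hc i]
    · simp only [map_mul, map_inv, FreeGroup.lift_apply_of, Option.elim]
      rw [ha i j hij, mul_inv_cancel]

section lift

variable {G : Type*} [Group G] {x : Fin d → G} {e : G} (hx : ∀ i, x i * x i = 1)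
    (he : e * e = 1) (hc : ∀ i, e * x i = x i * e)
    (ha : ∀ i j, i ≠ j → x i * x j = e * x j * x i)

@[simp]
lemma lift_xi (i : Fin d) : lift x e hx he hc ha (cliffXi i) = x i :=
  PresentedGroup.toGroup.of (rels := cliffRels d) _

@[simp]
lemma lift_eps : lift x e hx he hc ha (cliffEps d) = e :=
  PresentedGroup.toGroup.of (rels := cliffRels d) _

end lift

lemma hom_ext {G : Type*} [Group G] {f f' : CliffordGroup d →* G}
    (hx : ∀ i, f (cliffXi i) = f' (cliffXi i)) (he : f (cliffEps d) = f' (cliffEps d)) :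
    f = f' := by
  refine PresentedGroup.ext (rels := cliffRels d) (φ := f) (ψ := f') ?_
  rintro (_ | i)
  · exact he
  · exact hx i

lemma xi_mul_self (i : Fin d) : cliffXi i * cliffXi i = 1 :=
  PresentedGroup.one_of_mem (rels := cliffRels d) (.inl ⟨i, rfl⟩)

lemma eps_mul_self : cliffEps d * cliffEps d = 1 :=
  PresentedGroup.one_of_mem (rels := cliffRels d) (.inr (.inl rfl))

lemma eps_mul_xi (i : Fin d) : cliffEps d * cliffXi i = cliffXi i * cliffEps d := by
  have h : cliffEps d * cliffXi i * (cliffEps d)⁻¹ * (cliffXi i)⁻¹ = 1 :=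
    PresentedGroup.one_of_mem (rels := cliffRels d) (.inr (.inr (.inl ⟨i, rfl⟩)))
  rwa [mul_inv_eq_one, mul_inv_eq_iff_eq_mul] at h

lemma xi_mul_xi {i j : Fin d} (hij : i ≠ j) :
    cliffXi i * cliffXi j = cliffEps d * cliffXi j * cliffXi i := by
  have h : cliffXi i * cliffXi j * (cliffEps d * cliffXi j * cliffXi i)⁻¹ = 1 :=
    PresentedGroup.one_of_mem (rels := cliffRels d) (.inr (.inr (.inr ⟨i, j, hij, rfl⟩)))
  exact mul_inv_eq_one.1 h

/-- An element commuting with the images of the generators commutes with the whole image. -/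
lemma commute_map_of_generators {G : Type*} [Group G] (f : CliffordGroup d →* G) {y : G}
    (hx : ∀ i, Commute y (f (cliffXi i))) (he : Commute y (f (cliffEps d)))
    (x : CliffordGroup d) : Commute y (f x) := by
  have h : (MulAut.conj y).toMonoidHom.comp f = f :=
    hom_ext (fun i => mul_inv_eq_iff_eq_mul.2 (hx i)) (mul_inv_eq_iff_eq_mul.2 he)
  exact mul_inv_eq_iff_eq_mul.1 (DFunLike.congr_fun h x)

lemma commute_eps (x : CliffordGroup d) : Commute (cliffEps d) x :=
  commute_map_of_generators (MonoidHom.id _) eps_mul_xi (.refl _) x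

lemma eps_ne_one : cliffEps d ≠ 1 := by
  classical
  let Q : QuadraticForm ℚ (Fin d → ℚ) := QuadraticMap.weightedSumSquares ℚ (fun _ => (1 : ℚ))
  have hι : ∀ i, CliffordAlgebra.ι Q (Pi.single i 1) * CliffordAlgebra.ι Q (Pi.single i 1) = 1 := by
    intro i
    rw [CliffordAlgebra.ι_sq_scalar]
    have : Q (Pi.single i 1) = 1 := by
      simp [Q, QuadraticMap.weightedSumSquares_apply, Pi.single_apply]
    rw [this, map_one]
  let f : CliffordGroup d →* (CliffordAlgebra Q)ˣ :=
    lift (fun i => ⟨_, _, hι i, hι i⟩) (-1) (fun i => Units.ext (hι i)) (by simp)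
    (fun i => by simp) (fun i j hij => by
      ext
      simp only [Units.val_mul, Units.val_neg, neg_mul, one_mul]
      refine CliffordAlgebra.ι_mul_ι_comm_of_isOrtho ?_
      simp only [QuadraticMap.IsOrtho, Q, QuadraticMap.weightedSumSquares_apply,
        ← Finset.sum_add_distrib]
      refine Finset.sum_congr rfl fun k _ => ?_
      by_cases hi : k = i <;> by_cases hj : k = j <;> simp_all)
  have hf : f (cliffEps d) = -1 := lift_eps ..
  intro h
  rw [h, map_one] at hf
  have h1 : (1 : CliffordAlgebra Q) = -1 := congrArg Units.val hf
  have : Invertible (2 : ℚ) := invertibleOfNonzero two_ne_zero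
  have h2 : (algebraMap ℚ (CliffordAlgebra Q)) 2 = 0 := by
    rw [map_ofNat, ← one_add_one_eq_two]
    nth_rewrite 1 [h1]
    simp
  rw [map_eq_zero] at h2
  norm_num at h2

/-- The reduction of the Clifford group modulo its central element `ε`. -/
def parity (d : ℕ) : CliffordGroup d →* Multiplicative (Fin d → ZMod 2) :=
  lift (fun i => .ofAdd (Pi.single i 1)) 1
    (fun i => by
      rw [← ofAdd_add, ← Pi.single_add, CharTwo.add_self_eq_zero, Pi.single_zero, ofAdd_zero])
    (by simp) (fun i => by simp) (fun i j _ => by rw [one_mul, mul_comm])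

@[simp]
lemma parity_xi (i : Fin d) : parity d (cliffXi i) = .ofAdd (Pi.single i 1) := lift_xi ..

@[simp]
lemma parity_eps : parity d (cliffEps d) = 1 := lift_eps ..

lemma parity_surjective : Function.Surjective (parity d) := by
  intro v
  rw [← MonoidHom.mem_range]
  have hv : v = ∏ i, .ofAdd (Pi.single i (v.toAdd i)) := by
    rw [← ofAdd_sum, Finset.univ_sum_single, ofAdd_toAdd]
  rw [hv]
  refine Subgroup.prod_mem _ fun i _ => ?_
  generalize v.toAdd i = a
  fin_cases a
  · exact ⟨1, (map_one _).trans (congrArg Multiplicative.ofAdd (Pi.single_zero i)).symm⟩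
  · exact ⟨cliffXi i, parity_xi i⟩

lemma mem_zpowers_eps {x : CliffordGroup d} :
    x ∈ Subgroup.zpowers (cliffEps d) ↔ x = 1 ∨ x = cliffEps d := by
  constructor
  · rintro ⟨n, rfl⟩
    obtain ⟨k, rfl | rfl⟩ := n.even_or_odd'
    · left; simp [zpow_mul, zpow_ofNat, sq, eps_mul_self]
    · right; simp [zpow_mul, zpow_add, zpow_ofNat, sq, eps_mul_self]
  · rintro (rfl | rfl)
    · exact one_mem _
    · exact Subgroup.mem_zpowers _

lemma parity_ker : (parity d).ker = Subgroup.zpowers (cliffEps d) := by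
  refine le_antisymm ?_ (by simp [Subgroup.zpowers_le, MonoidHom.mem_ker])
  have hN : (Subgroup.zpowers (cliffEps d)).Normal := by
    refine ⟨fun n hn y => ?_⟩
    obtain ⟨k, rfl⟩ := hn
    refine ⟨k, ?_⟩
    rw [← ((commute_eps y).zpow_left k).eq, mul_inv_cancel_right]
  let q := QuotientGroup.mk' (Subgroup.zpowers (cliffEps d))
  have hqe : q (cliffEps d) = 1 := (QuotientGroup.eq_one_iff _).2 (Subgroup.mem_zpowers _)
  have hqx : ∀ i x, Commute (q (cliffXi i)) (q x) := fun i =>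
    commute_map_of_generators q (fun j => by
      by_cases hij : i = j
      · rw [hij]
      · rw [commute_iff_eq, ← map_mul, xi_mul_xi hij, map_mul, map_mul, hqe, one_mul])
      (by rw [hqe]; exact .one_right _)
  have hq : ∀ x y, Commute (q x) (q y) := fun x =>
    commute_map_of_generators q (fun j => (hqx j x).symm) (by rw [hqe]; exact .one_right _)
  let _ : CommGroup (CliffordGroup d ⧸ Subgroup.zpowers (cliffEps d)) :=
    { (inferInstance : Group (CliffordGroup d ⧸ Subgroup.zpowers (cliffEps d))) with
      mul_comm := by
        intro a b
        obtain ⟨x, rfl⟩ := QuotientGroup.mk'_surjective _ a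
        obtain ⟨y, rfl⟩ := QuotientGroup.mk'_surjective _ b
        exact hq x y }
  have hsq : ∀ i, q (cliffXi i) ^ 2 = 1 := fun i => by
    rw [sq, ← map_mul, xi_mul_self, map_one]
  let s : Multiplicative (Fin d → ZMod 2) →*
      CliffordGroup d ⧸ Subgroup.zpowers (cliffEps d) :=
    { toFun := fun v => ∏ i, q (cliffXi i) ^ (v.toAdd i).val
      map_one' := by simp
      map_mul' := fun v w => by
        rw [← Finset.prod_mul_distrib]
        refine Finset.prod_congr rfl fun i _ => ?_
        rw [toAdd_mul, Pi.add_apply, ZMod.val_add, ← pow_add, ← pow_eq_pow_mod _ (hsq i)] }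
  have hs : s.comp (parity d) = q := by
    refine hom_ext (fun i => ?_) ?_
    · rw [MonoidHom.comp_apply, parity_xi]
      change ∏ j, q (cliffXi j) ^ ((Pi.single i 1 : Fin d → ZMod 2) j).val = _
      rw [Finset.prod_eq_single i]
      · rw [Pi.single_eq_same, ZMod.val_one, pow_one]
      · intro j _ hj
        rw [Pi.single_eq_of_ne hj, ZMod.val_zero, pow_zero]
      · simp
    · rw [MonoidHom.comp_apply, parity_eps, map_one, hqe]
  intro x hx
  rw [MonoidHom.mem_ker] at hx
  refine (QuotientGroup.eq_one_iff x).1 ?_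
  change q x = 1
  rw [← hs, MonoidHom.comp_apply, hx, map_one]

lemma card_parity_ker : Nat.card (parity d).ker = 2 := by
  rw [parity_ker, Nat.card_zpowers]
  exact orderOf_eq_prime (by rw [sq, eps_mul_self]) eps_ne_one

lemma card_comap_parity (W : Subgroup (Multiplicative (Fin d → ZMod 2))) :
    Nat.card (W.comap (parity d)) = 2 * Nat.card W := by
  have h := Subgroup.relIndex_mul_relIndex ⊥ (parity d).ker (W.comap (parity d)) bot_le
    (Subgroup.ker_le_comap (parity d) W)
  rw [Subgroup.relIndex_bot_left, Subgroup.relIndex_bot_left, Subgroup.relIndex_ker,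
    Subgroup.map_comap_eq_self_of_surjective parity_surjective, card_parity_ker] at h
  exact h.symm

instance : Finite (CliffordGroup d) := by
  refine Nat.finite_of_card_ne_zero ?_
  have h := card_comap_parity (d := d) ⊤
  rw [Subgroup.comap_top, Subgroup.card_top, Subgroup.card_top] at h
  rw [h]
  exact mul_ne_zero two_ne_zero Nat.card_pos.ne'

/-- The parity vectors that are invariant under `g`. -/
def invariantParity (g : Equiv.Perm (Fin d)) : Subgroup (Multiplicative (Fin d → ZMod 2)) where
  carrier := {v | ∀ i, v.toAdd (g i) = v.toAdd i}
  one_mem' := fun _ => rfl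
  mul_mem' := fun hv hw i => congrArg₂ (· + ·) (hv i) (hw i)
  inv_mem' := fun hv i => congrArg (- ·) (hv i)

section action

variable {φ : Equiv.Perm (Fin d) →* MulAut (CliffordGroup d)}

lemma parity_action (hφ : ∀ (σ : Equiv.Perm (Fin d)) (i : Fin d), φ σ (cliffXi i) = cliffXi (σ i))
    (hφε : ∀ σ : Equiv.Perm (Fin d), φ σ (cliffEps d) = cliffEps d)
    (σ : Equiv.Perm (Fin d)) (x : CliffordGroup d) (i : Fin d) :
    (parity d (φ σ x)).toAdd (σ i) = (parity d x).toAdd i := by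
  let P : Multiplicative (Fin d → ZMod 2) →* Multiplicative (Fin d → ZMod 2) :=
    (LinearMap.funLeft (ZMod 2) (ZMod 2) σ).toAddMonoidHom.toMultiplicative
  have h : (P.comp (parity d)).comp (φ σ).toMonoidHom = parity d := by
    refine hom_ext (fun i => ?_) ?_
    · change P (parity d (φ σ (cliffXi i))) = _
      rw [hφ, parity_xi, parity_xi]
      refine congrArg Multiplicative.ofAdd (funext fun j => ?_)
      change (Pi.single (σ i) 1 : Fin d → ZMod 2) (σ j) = _
      simp [Pi.single_apply]
    · change P (parity d (φ σ (cliffEps d))) = _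
      rw [hφε, parity_eps, map_one]
  exact congrFun (congrArg Multiplicative.toAdd (DFunLike.congr_fun h x)) i

/-- A permutation of odd order fixes exactly the elements of the Clifford group whose parity it
fixes. -/
lemma fixed_iff_parity_invariant
    (hφ : ∀ (σ : Equiv.Perm (Fin d)) (i : Fin d), φ σ (cliffXi i) = cliffXi (σ i))
    (hφε : ∀ σ : Equiv.Perm (Fin d), φ σ (cliffEps d) = cliffEps d)
    {g : Equiv.Perm (Fin d)} (hg : Odd (orderOf g)) (x : CliffordGroup d) :
    φ g x = x ↔ x ∈ (invariantParity g).comap (parity d) := by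
  constructor
  · intro h i
    have := parity_action hφ hφε g x i
    rwa [h] at this
  · intro h
    have hp : parity d (φ g x) = parity d x := by
      refine congrArg Multiplicative.ofAdd (funext fun j => ?_)
      obtain ⟨i, rfl⟩ := g.surjective j
      exact (parity_action hφ hφε g x i).trans (h i).symm
    have hk : φ g x * x⁻¹ ∈ (parity d).ker := by
      rw [MonoidHom.mem_ker, map_mul, map_inv, hp, mul_inv_cancel]
    rw [parity_ker, mem_zpowers_eps, mul_inv_eq_one, mul_inv_eq_iff_eq_mul] at hk
    refine hk.resolve_right fun hε => ?_
    have hpow : ∀ n : ℕ, φ (g ^ n) x = cliffEps d ^ n * x := by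
      intro n
      induction n with
      | zero => simp
      | succ n ih =>
        rw [pow_succ', map_mul, MulAut.mul_apply, ih, map_mul, map_pow, hφε, hε, pow_succ,
          mul_assoc]
    have h1 := hpow (orderOf g)
    obtain ⟨k, hk⟩ := hg
    rw [pow_orderOf_eq_one, map_one, MulAut.one_apply, hk, pow_succ, pow_mul, sq, eps_mul_self,
      one_pow, one_mul] at h1
    exact eps_ne_one (mul_eq_right.1 h1.symm)

end action

end CliffordGroup

namespace Equiv.Perm

variable {α : Type*} [Fintype α] [DecidableEq α]

lemma card_quotient_sameCycle (g : Perm α) :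
    Nat.card (Quotient (SameCycle.setoid g)) = g.partition.parts.card := by
  let F : α → g.cycleFactorsFinset ⊕ Function.fixedPoints g := fun x =>
    if h : g x = x then .inr ⟨x, h⟩
    else .inl ⟨g.cycleOf x, cycleOf_mem_cycleFactorsFinset_iff.2 (mem_support.2 h)⟩
  have hF : ∀ x y, F x = F y ↔ g.SameCycle x y := by
    intro x y
    by_cases hx : g x = x <;> by_cases hy : g y = y
    · simp only [F, hx, hy, dif_pos, Sum.inr.injEq]
      exact ⟨fun h => Subtype.mk.inj h ▸ .refl _ _, fun h => Subtype.ext (h.eq_of_left hx)⟩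
    · simp only [F, hx, hy, dif_pos, dif_neg, not_false_eq_true, reduceCtorEq, false_iff]
      exact fun h => hy (h.apply_eq_self_iff.1 hx)
    · simp only [F, hx, hy, dif_pos, dif_neg, not_false_eq_true, reduceCtorEq, false_iff]
      exact fun h => hx (h.apply_eq_self_iff.2 hy)
    · simp only [F, hx, hy, dif_neg, not_false_eq_true, Sum.inl.injEq, Subtype.mk.injEq]
      exact (sameCycle_iff_cycleOf_eq_of_mem_support (mem_support.2 hx) (mem_support.2 hy)).symm
  have hsurj : Function.Surjective F := by
    rintro (⟨c, hc⟩ | ⟨x, hx⟩)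
    · obtain ⟨x, hx⟩ := (mem_cycleFactorsFinset_iff.1 hc).1.nonempty_support
      have hgx : g x ≠ x := mem_support.1 (mem_cycleFactorsFinset_support_le hc hx)
      exact ⟨x, (dif_neg hgx).trans
        (congrArg Sum.inl (Subtype.ext (cycle_is_cycleOf hx hc).symm))⟩
    · exact ⟨x, dif_pos hx⟩
  have e : Quotient (SameCycle.setoid g) ≃ g.cycleFactorsFinset ⊕ Function.fixedPoints g :=
    Equiv.ofBijective (Quotient.lift F fun x y h => (hF x y).2 h)
      ⟨by
        rintro ⟨x⟩ ⟨y⟩ h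
        exact Quotient.sound ((hF x y).1 h), by
        intro z
        obtain ⟨x, hx⟩ := hsurj z
        exact ⟨Quotient.mk _ x, hx⟩⟩
  rw [Nat.card_congr e, Nat.card_sum, parts_partition, Multiset.card_add, Multiset.card_replicate,
    cycleType_def, Multiset.card_map, Nat.card_eq_fintype_card, Nat.card_eq_fintype_card,
    Fintype.card_coe, Finset.card_def, card_fixedPoints, sum_cycleType]

/-- Functions constant along the cycles of `g`. -/
def invariantFunctionsEquiv (g : Perm α) (β : Type*) :
    {v : α → β // ∀ i, v (g i) = v i} ≃ (Quotient (SameCycle.setoid g) → β) where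
  toFun v := Quotient.lift v.1 <| by
    intro x y h
    obtain ⟨n, -, rfl⟩ := SameCycle.exists_pow_eq' h
    induction n with
    | zero => rfl
    | succ n ih => rw [pow_succ', mul_apply, v.2, ih (sameCycle_pow_right.2 (.refl _ _))]
  invFun w := ⟨fun x => w (Quotient.mk _ x), fun x =>
    congrArg w (Quotient.sound (s := SameCycle.setoid g) (sameCycle_apply_left.2 (.refl _ _)))⟩
  left_inv v := rfl
  right_inv w := by
    ext ⟨x⟩
    rfl

lemma nat_card_centralizer_eq_prod_parts (g : Perm α) :
    Nat.card (Subgroup.centralizer {g}) = ∏ k ∈ g.partition.parts.toFinset,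
      k ^ g.partition.parts.count k * Nat.factorial (g.partition.parts.count k) := by
  have h1 : 1 ∉ g.cycleType := fun h => (one_lt_of_mem_cycleType h).false
  rw [Finset.prod_mul_distrib, ← Finset.prod_multiset_count]
  have hsub : g.partition.parts.toFinset ⊆ insert 1 g.cycleType.toFinset := by
    intro k hk
    simp only [parts_partition, Multiset.mem_toFinset, Multiset.mem_add,
      Multiset.mem_replicate] at hk
    simp only [Finset.mem_insert, Multiset.mem_toFinset]
    tauto
  rw [Finset.prod_subset (f := fun k => Nat.factorial (g.partition.parts.count k)) hsub
    (fun k _ hk => by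
      rw [Multiset.count_eq_zero_of_notMem (by simpa using hk), Nat.factorial_zero]),
    Finset.prod_insert (by simpa using h1), nat_card_centralizer]
  have hc : ∀ k ∈ g.cycleType.toFinset, Nat.factorial (g.partition.parts.count k) =
      Nat.factorial (g.cycleType.count k) := by
    intro k hk
    have : k ≠ 1 := by rintro rfl; exact h1 (Multiset.mem_toFinset.1 hk)
    simp [parts_partition, Multiset.count_replicate, this.symm]
  rw [Finset.prod_congr rfl hc]
  simp [parts_partition, Multiset.count_eq_zero_of_notMem h1, sum_cycleType]
  ring

lemma odd_orderOf_of_odd_parts {g : Perm α} (h : ∀ p ∈ g.partition.parts, Odd p) :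
    Odd (orderOf g) := by
  rw [← lcm_cycleType]
  have h' : ∀ p ∈ g.cycleType, Odd p := fun p hp => h p (by simp [parts_partition, hp])
  generalize g.cycleType = s at h'
  induction s using Multiset.induction_on with
  | empty => simp
  | cons a s ih =>
    simp only [Multiset.mem_cons, forall_eq_or_imp] at h'
    rw [Multiset.lcm_cons]
    exact (h'.1.mul (ih h'.2)).of_dvd_nat (lcm_dvd_mul _ _)

end Equiv.Perm

namespace CliffordGroup

lemma card_invariantParity {d : ℕ} (g : Equiv.Perm (Fin d)) :
    Nat.card (invariantParity g) = 2 ^ g.partition.parts.card := by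
  have e : invariantParity g ≃ {v : Fin d → ZMod 2 // ∀ i, v (g i) = v i} := Equiv.refl _
  rw [Nat.card_congr (e.trans (g.invariantFunctionsEquiv (ZMod 2))), Nat.card_fun, Nat.card_zmod,
    g.card_quotient_sameCycle]

end CliffordGroup

namespace SemidirectProduct

lemma card_centralizer_inr {N G : Type*} [Group N] [Group G] {φ : G →* MulAut N} (g : G) :
    Nat.card (Subgroup.centralizer {(inr g : N ⋊[φ] G)}) =
      Nat.card {x : N // φ g x = x} * Nat.card (Subgroup.centralizer {g}) := by
  have h : ∀ x : N ⋊[φ] G, x ∈ Subgroup.centralizer {(inr g : N ⋊[φ] G)} ↔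
      φ g x.left = x.left ∧ x.right ∈ Subgroup.centralizer {g} := by
    intro x
    simp only [Subgroup.mem_centralizer_singleton_iff, SemidirectProduct.ext_iff]
    simp [eq_comm]
  rw [← Nat.card_prod]
  refine Nat.card_congr ⟨fun x => (⟨x.1.left, ((h x).1 x.2).1⟩, ⟨x.1.right, ((h x).1 x.2).2⟩),
    fun y => ⟨⟨y.1.1, y.2.1⟩, (h _).2 ⟨y.1.2, y.2.2⟩⟩, fun _ => rfl, fun _ => rfl⟩

end SemidirectProduct

lemma card_isConj_eq_div {G : Type*} [Group G] [Finite G] (g : G) :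
    Nat.card {x : G | IsConj g x} = Nat.card G / Nat.card (Subgroup.centralizer {g}) := by
  classical
  have := Fintype.ofFinite G
  have h := ConjClasses.card_carrier g
  rw [Subgroup.nat_card_centralizer_nat_card_stabilizer, Nat.card_eq_fintype_card (α := G),
    Nat.card_eq_fintype_card (α := MulAction.stabilizer _ _), ← h, ← Nat.card_eq_fintype_card]
  refine Nat.card_congr (Equiv.subtypeEquivRight fun x => ?_)
  rw [ConjClasses.mem_carrier_iff_mk_eq, ConjClasses.mk_eq_mk_iff_isConj, isConj_comm]
  rfl

/-- For a pure permutation `g ∈ S(d) ⊂ C(d)` with odd cycle type `γ`, the centralizer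
of `g` in the Sergeev group `C(d)` has order `2^(ℓ(γ)+1)·z_γ`, and consequently the
conjugacy class `C_γ` of `g` satisfies `|C_γ| = |C(d)| / (2^(ℓ(γ)+1) z_γ)`. -/
theorem stmt_7 (d : ℕ) (φ : Equiv.Perm (Fin d) →* MulAut (CliffordGroup d))
    (hφ : ∀ (σ : Equiv.Perm (Fin d)) (i : Fin d), φ σ (cliffXi i) = cliffXi (σ i))
    (hφε : ∀ σ : Equiv.Perm (Fin d), φ σ (cliffEps d) = cliffEps d)
    (g : Equiv.Perm (Fin d)) (γ : Nat.Partition d)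
    (hg : (Equiv.Perm.partition g).parts = γ.parts)
    (hodd : ∀ p ∈ γ.parts, Odd p)
    (zγ : ℕ)
    (hz : zγ = ∏ k ∈ γ.parts.toFinset,
      k ^ γ.parts.count k * Nat.factorial (γ.parts.count k)) :
    Nat.card (Subgroup.centralizer
        {(inr g : CliffordGroup d ⋊[φ] Equiv.Perm (Fin d))}) =
      2 ^ (γ.parts.card + 1) * zγ ∧
    Nat.card {x : CliffordGroup d ⋊[φ] Equiv.Perm (Fin d) | IsConj (inr g) x} =
      Nat.card (CliffordGroup d ⋊[φ] Equiv.Perm (Fin d)) / (2 ^ (γ.parts.card + 1) * zγ) := by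
  have hg' : g.partition.parts = γ.parts := hg
  have hfix : Nat.card {x : CliffordGroup d // φ g x = x} = 2 ^ (γ.parts.card + 1) := by
    have hodd' : Odd (orderOf g) := Equiv.Perm.odd_orderOf_of_odd_parts (by rwa [hg'])
    rw [Nat.card_congr (Equiv.subtypeEquivRight
      (CliffordGroup.fixed_iff_parity_invariant hφ hφε hodd'))]
    exact (CliffordGroup.card_comap_parity _).trans
      (by rw [CliffordGroup.card_invariantParity, hg', pow_succ'])
  have hcent : Nat.card (Subgroup.centralizer
      {(inr g : CliffordGroup d ⋊[φ] Equiv.Perm (Fin d))}) = 2 ^ (γ.parts.card + 1) * zγ := by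
    rw [card_centralizer_inr, hfix, g.nat_card_centralizer_eq_prod_parts, hz, hg']
  have : Finite (CliffordGroup d ⋊[φ] Equiv.Perm (Fin d)) := .of_equiv _ equivProd.symm
  exact ⟨hcent, by rw [card_isConj_eq_div, hcent]⟩
end

section
/- Let G be a finite group, C_1,…,C_k conjugacy classes of G, and n(C_1,…,C_k) the number of tuples (g_1,…,g_k) ∈ C_1 × ⋯ × C_k with g_1⋯g_k = 1. Then n(C_1,…,C_k) = |G| · Σ_{V irreducible complex representation of G} (dim V / |G|)² · ∏_{i=1}^k f_{C_i}(V), where f_{C_i}(V) = |C_i|·χ_V(C_i)/dim V is the central character of V at C_i. -/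
open Finset

/-- A sum of values of a monoid homomorphism over a box of tuples is a product of sums. -/
theorem sum_piFinset_map_prod_ofFn {G A : Type*} [Monoid G] [Semiring A] (F : G →* A) :
    ∀ {k : ℕ} (S : Fin k → Finset G),
      ∑ x ∈ Fintype.piFinset S, F (List.ofFn x).prod =
        (List.ofFn fun j => ∑ y ∈ S j, F y).prod
  | 0, S => by simp
  | k + 1, S => by
    rw [List.ofFn_succ, List.prod_cons, ← sum_piFinset_map_prod_ofFn F (fun j => S j.succ),
      Finset.sum_mul_sum, ← Finset.sum_product']
    refine Finset.sum_equiv (Fin.consEquiv fun _ => G).symm (fun x => ?_) fun x _ => ?_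
    · simp [Fintype.mem_piFinset, Fin.forall_fin_succ, Fin.consEquiv, Fin.tail]
    · simp [List.ofFn_succ, Fin.consEquiv, Fin.tail_def]

open Matrix ComplexOrder in
/-- The trace of a finite group matrix representation at `h⁻¹` is the conjugate of that at `h`. -/
theorem trace_map_inv_eq_star {G n : Type*} [Group G] [Fintype G] [Fintype n] [DecidableEq n]
    (R : G →* Matrix n n ℂ) (h : G) : (R h⁻¹).trace = star (R h).trace := by
  classical
  set H : Matrix n n ℂ := ∑ g, (R g)ᴴ * R g with hH
  have hpos : H.PosDef := by
    rw [hH, ← Finset.add_sum_erase _ _ (Finset.mem_univ (1 : G))]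
    refine Matrix.PosDef.add_posSemidef (by simpa using Matrix.PosDef.one) ?_
    exact Matrix.posSemidef_sum _ fun g _ => Matrix.posSemidef_conjTranspose_mul_self _
  have hinv : (R h)ᴴ * H * R h = H := by
    simp only [hH, Finset.mul_sum, Finset.sum_mul]
    refine Fintype.sum_equiv (Equiv.mulRight h) _ _ fun g => ?_
    simp [Matrix.mul_assoc]
  have hconj : (R h)ᴴ * H = H * R h⁻¹ := by
    have := congrArg (· * R h⁻¹) hinv
    simpa [Matrix.mul_assoc, ← map_mul] using this
  have hdet : IsUnit H.det := (Matrix.isUnit_iff_isUnit_det H).1 hpos.isUnit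
  calc (R h⁻¹).trace = (H * R h⁻¹ * H⁻¹).trace := by
        rw [Matrix.trace_mul_comm, Matrix.nonsing_inv_mul_cancel_left _ _ hdet]
    _ = (R h)ᴴ.trace := by rw [← hconj, Matrix.mul_nonsing_inv_cancel_right _ _ hdet]
    _ = star (R h).trace := Matrix.trace_conjTranspose _

namespace FDRep

variable {G : Type} [Group G]

theorem character_inv_eq_star [Fintype G] (V : FDRep ℂ G) (h : G) :
    V.character h⁻¹ = star (V.character h) := by
  let b := Module.finBasis ℂ V
  have key := trace_map_inv_eq_star
    ((MonoidHomClass.toMonoidHom (LinearMap.toMatrixAlgEquiv b)).comp V.ρ) h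
  simpa [character, LinearMap.trace_eq_matrix_trace ℂ b, LinearMap.toMatrixAlgEquiv] using key

theorem finrank_ne_zero_of_simple (V : FDRep ℂ G) [Fintype G] [CategoryTheory.Simple V] :
    Module.finrank ℂ V ≠ 0 := by
  intro h
  have := Module.finrank_zero_iff.1 h
  have hnorm := V.simple_iff_char_is_norm_one.1 inferInstance
  have hchar : ∀ g, V.character g = 0 := fun g => by
    rw [character, Subsingleton.elim (V.ρ g) 0, map_zero]
  simp only [hchar, mul_zero, Finset.sum_const_zero] at hnorm
  exact Nat.cast_ne_zero.2 Nat.card_pos.ne' hnorm.symm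

/-- **Schur's lemma**: an endomorphism commuting with a simple representation is a scalar. -/
theorem exists_eq_smul_one_of_commute (V : FDRep ℂ G) [CategoryTheory.Simple V]
    (T : Module.End ℂ V) (hT : ∀ g, Commute T (V.ρ g)) : ∃ c : ℂ, T = c • 1 := by
  let f : V ⟶ V := forget₂HomLinearEquiv V V (Rep.ofHom ⟨T, fun g => hT g⟩)
  obtain ⟨c, hc⟩ := CategoryTheory.endomorphism_simple_eq_smul_id ℂ f
  refine ⟨c, LinearMap.ext fun v => ?_⟩
  have := congrArg (fun φ : V ⟶ V => φ.hom.hom.hom v) hc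
  exact this.symm

/-- A class sum acts on a simple representation by its central character. -/
theorem sum_conj_eq_smul_one (V : FDRep ℂ G) [Fintype G] [CategoryTheory.Simple V] (g : G)
    (S : Finset G) (hS : ∀ y, y ∈ S ↔ IsConj g y) :
    ∑ y ∈ S, V.ρ y = ((S.card : ℂ) * V.character g / Module.finrank ℂ V) • 1 := by
  have hcomm : ∀ h, Commute (∑ y ∈ S, V.ρ y) (V.ρ h) := fun h => by
    rw [Commute, SemiconjBy, Finset.sum_mul, Finset.mul_sum]
    refine Finset.sum_equiv (MulAut.conj h⁻¹).toEquiv (fun y => ?_) fun y _ => ?_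
    · have hy : IsConj y (MulAut.conj h⁻¹ y) := isConj_iff.2 ⟨h⁻¹, rfl⟩
      rw [hS, hS]
      exact ⟨fun H => H.trans hy, fun H => H.trans hy.symm⟩
    · simp [← map_mul, mul_assoc]
  obtain ⟨c, hc⟩ := V.exists_eq_smul_one_of_commute _ hcomm
  have hd : (Module.finrank ℂ V : ℂ) ≠ 0 := Nat.cast_ne_zero.2 V.finrank_ne_zero_of_simple
  have htrace := congrArg (LinearMap.trace ℂ V) hc
  have hchar : ∀ y ∈ S, LinearMap.trace ℂ V (V.ρ y) = V.character g := fun y hy => by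
    obtain ⟨a, rfl⟩ := isConj_iff.1 ((hS y).1 hy)
    exact V.char_conj g a
  rw [map_sum, Finset.sum_congr rfl hchar, Finset.sum_const, nsmul_eq_mul, map_smul,
    LinearMap.trace_one, smul_eq_mul] at htrace
  rw [hc, htrace, mul_div_cancel_right₀ _ hd]

/-- **Column orthogonality at the identity**: the character of the regular representation in terms
of irreducible characters. -/
theorem sum_finrank_mul_character [Fintype G] [DecidableEq G] {ι : Type} [Fintype ι]
    (V : ι → FDRep ℂ G) (hsimple : ∀ i, CategoryTheory.Simple (V i))
    (hdistinct : ∀ i j, i ≠ j → IsEmpty (V i ≅ V j))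
    (hcomplete : ∑ i, (Module.finrank ℂ (V i)) ^ 2 = Nat.card G) (g : G) :
    ∑ i, (Module.finrank ℂ (V i) : ℂ) * (V i).character g =
      if g = 1 then (Nat.card G : ℂ) else 0 := by
  classical
  have hG : (Nat.card G : ℂ) ≠ 0 := Nat.cast_ne_zero.2 Nat.card_pos.ne'
  have := invertibleOfNonzero hG
  have horth : ∀ i j, ∑ g, (V i).character g * (V j).character g⁻¹ =
      if i = j then (Nat.card G : ℂ) else 0 := fun i j => by
    have h := char_orthonormal (V i) (V j)
    rw [inv_mul_eq_iff_eq_mul₀ hG] at h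
    rw [h]
    by_cases hij : i = j
    · subst hij
      simp [Nonempty.intro (CategoryTheory.Iso.refl (V i))]
    · simp [hij, hdistinct i j hij]
  have hdim : ∑ i, (Module.finrank ℂ (V i) : ℂ) ^ 2 = Nat.card G := mod_cast hcomplete
  set s : G → ℂ := fun g => ∑ i, (Module.finrank ℂ (V i) : ℂ) * (V i).character g with hs
  set r : G → ℂ := fun g => if g = 1 then (Nat.card G : ℂ) else 0 with hr
  have hs_one : s 1 = Nat.card G := by simp only [hs, char_one, ← sq, hdim]
  have hs_star : ∀ g, s g⁻¹ = star (s g) := fun g => by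
    simp [hs, character_inv_eq_star]
  have hr_star : ∀ g, r g⁻¹ = star (r g) := fun g => by
    by_cases h : g = 1 <;> simp [hr, h]
  have hss : ∑ g, s g * s g⁻¹ = (Nat.card G : ℂ) ^ 2 := by
    simp only [hs, Finset.sum_mul_sum]
    rw [Finset.sum_comm]
    refine (Finset.sum_congr rfl fun i _ => Finset.sum_comm.trans <|
      Finset.sum_congr rfl fun j _ => (Finset.sum_congr rfl fun g _ =>
        mul_mul_mul_comm _ _ _ _).trans (Finset.mul_sum _ _ _).symm).trans ?_
    simp only [horth, mul_ite, mul_zero, Finset.sum_ite_eq, Finset.mem_univ, if_true, ← sq,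
      ← Finset.sum_mul, hdim]
  have hnorm : ∑ g, (s g - r g) * star (s g - r g) = 0 := by
    have hexp : ∀ g, (s g - r g) * star (s g - r g) =
        s g * s g⁻¹ - s g * r g⁻¹ - r g * s g⁻¹ + r g * r g⁻¹ := fun g => by
      rw [star_sub, ← hs_star, ← hr_star]; ring
    simp only [hexp, Finset.sum_add_distrib, Finset.sum_sub_distrib, hss]
    simp [hr, hs_one]
    ring
  have hzero : ∑ g, Complex.normSq (s g - r g) = 0 := by
    have := hnorm
    simp only [Complex.star_def, Complex.mul_conj] at this
    exact_mod_cast this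
  have := (Finset.sum_eq_zero_iff_of_nonneg fun g _ => Complex.normSq_nonneg _).1 hzero g
    (Finset.mem_univ g)
  exact sub_eq_zero.1 (Complex.normSq_eq_zero.1 this)

/-- The character sum over a product of conjugacy classes, in terms of central characters. -/
theorem sum_piFinset_character_prod (V : FDRep ℂ G) [Fintype G] [CategoryTheory.Simple V]
    {k : ℕ} (g : Fin k → G) (S : Fin k → Finset G) (hS : ∀ j y, y ∈ S j ↔ IsConj (g j) y) :
    ∑ x ∈ Fintype.piFinset S, V.character (List.ofFn x).prod =
      Module.finrank ℂ V *
        ∏ j, (((S j).card : ℂ) * V.character (g j) / Module.finrank ℂ V) := by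
  simp only [character, ← map_sum]
  rw [sum_piFinset_map_prod_ofFn]
  simp only [fun j => V.sum_conj_eq_smul_one (g j) (S j) (hS j), ← Algebra.algebraMap_eq_smul_one]
  have hprod : ∀ c : Fin k → ℂ, (List.ofFn fun j => algebraMap ℂ (Module.End ℂ V) (c j)).prod =
      algebraMap ℂ (Module.End ℂ V) (∏ j, c j) := fun c => by
    rw [← List.prod_ofFn, map_list_prod, List.map_ofFn]; rfl
  rw [hprod, Algebra.algebraMap_eq_smul_one, map_smul, LinearMap.trace_one, smul_eq_mul, mul_comm]
  rfl

end FDRep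

/-- Frobenius/Burnside formula: for conjugacy classes `C₁,…,C_k` of a finite group `G`
(with representatives `g i`), the number of tuples `(g₁,…,g_k) ∈ C₁×⋯×C_k` with
`g₁⋯g_k = 1` equals `|G| · ∑_V (dim V/|G|)² ∏ᵢ f_{Cᵢ}(V)`, the sum being over a
complete set of pairwise non-isomorphic irreducible complex representations of `G`,
where `f_C(V) = |C|·χ_V(C)/dim V` is the central character. -/
theorem stmt_9 (G : Type) [Group G] [Fintype G] (k : ℕ) (g : Fin k → G)
    {ι : Type} [Fintype ι] (V : ι → FDRep ℂ G)
    (hsimple : ∀ i, CategoryTheory.Simple (V i))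
    (hdistinct : ∀ i j, i ≠ j → IsEmpty (V i ≅ V j))
    (hcomplete : ∑ i, (Module.finrank ℂ (V i)) ^ 2 = Nat.card G) :
    (Nat.card {x : Fin k → G //
        (∀ i, IsConj (g i) (x i)) ∧ (List.ofFn x).prod = 1} : ℂ) =
      (Nat.card G : ℂ) * ∑ i : ι,
        ((Module.finrank ℂ (V i) : ℂ) / (Nat.card G : ℂ)) ^ 2 *
          ∏ j : Fin k, ((Nat.card {y : G | IsConj (g j) y} : ℂ) *
            (V i).character (g j) / (Module.finrank ℂ (V i) : ℂ)) := by
  classical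
  have hG : (Nat.card G : ℂ) ≠ 0 := Nat.cast_ne_zero.2 Nat.card_pos.ne'
  let S : Fin k → Finset G := fun j => Finset.univ.filter fun y => IsConj (g j) y
  have hS : ∀ j y, y ∈ S j ↔ IsConj (g j) y := fun j y => by simp [S]
  have hcard : ∀ j, Nat.card {y : G | IsConj (g j) y} = (S j).card := fun j => by
    rw [Nat.card_eq_fintype_card, Fintype.card_subtype]; rfl
  have hcount : (Nat.card {x : Fin k → G //
      (∀ i, IsConj (g i) (x i)) ∧ (List.ofFn x).prod = 1} : ℂ) =
      ∑ x ∈ Fintype.piFinset S, if (List.ofFn x).prod = 1 then 1 else 0 := by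
    rw [Finset.sum_boole, Nat.card_eq_fintype_card, Fintype.card_subtype]
    congr 2
    ext x
    simp [Fintype.mem_piFinset, hS]
  have hsum : (Nat.card G : ℂ) * (∑ x ∈ Fintype.piFinset S,
      if (List.ofFn x).prod = 1 then 1 else 0) =
      ∑ i, (Module.finrank ℂ (V i) : ℂ) *
        ∑ x ∈ Fintype.piFinset S, (V i).character (List.ofFn x).prod := by
    simp_rw [Finset.mul_sum]
    rw [Finset.sum_comm]
    refine Finset.sum_congr rfl fun x _ => ?_
    rw [FDRep.sum_finrank_mul_character V hsimple hdistinct hcomplete, mul_ite, mul_one, mul_zero]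
  rw [hcount]
  refine mul_left_cancel₀ hG ?_
  rw [hsum, Finset.mul_sum, Finset.mul_sum]
  refine Finset.sum_congr rfl fun i _ => ?_
  have := hsimple i
  rw [(V i).sum_piFinset_character_prod g S hS]
  simp only [hcard]
  field_simp
end
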